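/- arXiv:2503.23845 — 2 statements merged into one kernel-verified Lean document; each statement's English description precedes it below -/
import Mathlib

section
/- Let G be a finite group and H a subgroup. Then H is core-free in G if and only if the Külshammer graph K(G,H) is connected; that is, if and only if for any two irreducible complex characters α, β of H there is a finite chain α = α₀, α₁, …, α_m = β of irreducible complex characters of H in which consecutive characters are linked over G. -/
noncomputable section

/-- The usual inner product of class functions on a finite group `H`. -/
def charInner (H : Type) (φ ψ : H → ℂ) : ℂ :=
  (Nat.card H : ℂ)⁻¹ * ∑ᶠ h : H, φ h * (starRingEnd ℂ) (ψ h)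

/-- `χ : H → ℂ` is the character of an irreducible complex representation of `H`. -/
def IsIrrChar (H : Type) [Group H] (χ : H → ℂ) : Prop :=
  ∃ V : FDRep ℂ H, CategoryTheory.Simple V ∧ χ = V.character

/-- Restriction of a class function on `G` to a subgroup `H`. -/
def resChar {G : Type} [Group G] (H : Subgroup G) (χ : G → ℂ) : ↥H → ℂ :=
  fun h => χ (h : G)

/-- Two irreducible characters `α, β` of a subgroup `H ≤ G` are linked over `G` if some
irreducible character `χ` of `G` satisfies `⟨χ|_H, α⟩ ≠ 0` and `⟨χ|_H, β⟩ ≠ 0`. -/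
def Linked {G : Type} [Group G] (H : Subgroup G) (α β : ↥H → ℂ) : Prop :=
  ∃ χ : G → ℂ, IsIrrChar G χ ∧
    charInner ↥H (resChar H χ) α ≠ 0 ∧ charInner ↥H (resChar H χ) β ≠ 0

/-- `α` and `β` are joined by a path of length at most `m` in the Külshammer graph
`K(G,H)`: there is a chain of irreducible characters of `H`, of length `k ≤ m`, from `α`
to `β` in which consecutive members are linked over `G`. -/
def LinkedPathLE {G : Type} [Group G] (H : Subgroup G) (m : ℕ) (α β : ↥H → ℂ) : Prop :=
  ∃ k ≤ m, ∃ f : ℕ → (↥H → ℂ), f 0 = α ∧ f k = β ∧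
    (∀ i ≤ k, IsIrrChar ↥H (f i)) ∧ ∀ i < k, Linked H (f i) (f (i + 1))

/-- The conjugate subgroup `g H g⁻¹`. -/
def conjSub {G : Type} [Group G] (g : G) (H : Subgroup G) : Subgroup G :=
  H.map (MulAut.conj g).toMonoidHom

open Representation MonoidAlgebra

theorem FDRep.isIrreducible_of_simple {G : Type} [Group G] (X : FDRep ℂ G)
    [CategoryTheory.Simple X] :
    IsIrreducible X.ρ := by
  have hbot : ∀ N : Subrepresentation X.ρ, N ≠ ⊥ → N = ⊤ := fun N hN ↦ by
    let f : FDRep.of N.toRepresentation ⟶ X :=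
      ⟨CategoryTheory.InducedCategory.homMk (ModuleCat.ofHom N.toSubmodule.subtype), fun g ↦ rfl⟩
    have hf : ∀ x, f x = x.1 := fun x ↦ rfl
    have : CategoryTheory.Mono f :=
      CategoryTheory.ConcreteCategory.mono_of_injective f Subtype.val_injective
    have : CategoryTheory.IsIso f := by
      refine CategoryTheory.isIso_of_mono_of_nonzero fun h0 ↦ hN ?_
      refine Subrepresentation.toSubmodule_injective ((Submodule.eq_bot_iff _).mpr fun x hx ↦ ?_)
      exact (hf ⟨x, hx⟩).symm.trans (by rw [h0]; rfl)
    refine Subrepresentation.toSubmodule_injective (Submodule.eq_top_iff'.mpr fun x ↦ ?_)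
    obtain ⟨y, rfl⟩ := (CategoryTheory.ConcreteCategory.bijective_of_isIso f).2 x
    exact y.2
  have hne : (⊥ : Subrepresentation X.ρ) ≠ ⊤ := fun h ↦ by
    refine CategoryTheory.id_nonzero X ?_
    ext x
    have hx : x ∈ (⊤ : Subrepresentation X.ρ).toSubmodule := Submodule.mem_top
    rw [← h] at hx
    exact (Submodule.mem_bot ℂ).mp hx
  have : Nontrivial (Subrepresentation X.ρ) := ⟨⊥, ⊤, hne⟩
  exact ⟨fun N ↦ or_iff_not_imp_left.mpr (hbot N)⟩

section

variable {G V W : Type} [Group G] [Finite G] [AddCommGroup V] [Module ℂ V] [FiniteDimensional ℂ V]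
  [AddCommGroup W] [Module ℂ W] [FiniteDimensional ℂ W]

theorem Representation.isSemisimple_apply {V : Type*} [AddCommGroup V] [Module ℂ V]
    (ρ : Representation ℂ G V) (g : G) :
    Module.End.IsSemisimple (ρ g) := by
  refine Module.End.isSemisimple_of_squarefree_aeval_eq_zero
    (p := Polynomial.X ^ Nat.card G - 1)
    (Polynomial.X_pow_sub_one_separable_iff.mpr (NeZero.ne _)).squarefree ?_
  rw [map_sub, map_one, map_pow, Polynomial.aeval_X, ← map_pow, pow_card_eq_one', map_one,
    sub_self]

theorem Representation.char_inv_eq_conj (ρ : Representation ℂ G V) (g : G) :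
    ρ.character g⁻¹ = (starRingEnd ℂ) (ρ.character g) := by
  classical
  have hint : DirectSum.IsInternal (Module.End.eigenspace (ρ g)) :=
    DirectSum.isInternal_submodule_of_iSupIndep_of_iSup_eq_top
      (Module.End.eigenspaces_iSupIndep (ρ g)) (ρ.isSemisimple_apply g).iSup_eigenspace_eq_top
  have hfin : {μ | Module.End.eigenspace (ρ g) μ ≠ ⊥}.Finite :=
    WellFoundedGT.finite_ne_bot_of_iSupIndep (Module.End.eigenspaces_iSupIndep (ρ g))
  have hmaps (k : G) (hk : Commute g k) (μ : ℂ) :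
      Set.MapsTo (ρ k) (Module.End.eigenspace (ρ g) μ) (Module.End.eigenspace (ρ g) μ) := by
    intro x hx
    simp only [SetLike.mem_coe, Module.End.mem_eigenspace_iff] at hx ⊢
    rw [← Module.End.mul_apply, ← map_mul, hk.eq, map_mul, Module.End.mul_apply, hx, map_smul]
  have htrace (k : G) (hk : Commute g k) := LinearMap.trace_eq_sum_trace_restrict' hint hfin
    (hmaps k hk)
  rw [character, character, htrace g⁻¹ (.inv_right rfl), htrace g rfl, map_sum]
  refine Finset.sum_congr rfl fun μ hμ ↦ ?_
  have hg : (ρ g).restrict (hmaps g rfl μ) = μ • LinearMap.id := by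
    ext x
    exact Module.End.mem_eigenspace_iff.mp x.2
  obtain ⟨v, hv, hv0⟩ := Submodule.exists_mem_ne_zero_of_ne_bot (hfin.mem_toFinset.mp hμ)
  have hpow : μ ^ Nat.card G = 1 := by
    have h : ∀ n : ℕ, (ρ (g ^ n)) v = μ ^ n • v := fun n ↦ by
      induction n with
      | zero => simp
      | succ n ih =>
        rw [pow_succ, map_mul, Module.End.mul_apply, Module.End.mem_eigenspace_iff.mp hv, map_smul,
          ih, smul_smul, pow_succ']
    have h1 := h (Nat.card G)
    rw [pow_card_eq_one', map_one, Module.End.one_apply] at h1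
    exact smul_left_injective ℂ hv0 (by simpa using h1.symm)
  have hnorm : ‖μ‖ = 1 := Complex.norm_eq_one_of_pow_eq_one hpow Nat.card_pos.ne'
  have hμ0 : μ ≠ 0 := by rintro rfl; simp at hnorm
  have hinv : (ρ g⁻¹).restrict (hmaps g⁻¹ (.inv_right rfl) μ) = μ⁻¹ • LinearMap.id := by
    ext x
    have hx := Module.End.mem_eigenspace_iff.mp x.2
    have h2 : ρ g⁻¹ (ρ g x) = x := by
      rw [← Module.End.mul_apply, ← map_mul, inv_mul_cancel, map_one, Module.End.one_apply]
    rw [hx, map_smul] at h2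
    exact (inv_smul_eq_iff₀ hμ0).mpr h2.symm |>.symm
  rw [hg, hinv, map_smul, map_smul, LinearMap.trace_id, smul_eq_mul, smul_eq_mul, map_mul,
    Complex.inv_eq_conj hnorm, map_natCast]

theorem charInner_character (ρ : Representation ℂ G V) (σ : Representation ℂ G W) :
    charInner G σ.character ρ.character = Module.finrank ℂ (IntertwiningMap ρ σ) := by
  have := Fintype.ofFinite G
  have : Invertible (Nat.card G : ℂ) := invertibleOfNonzero (NeZero.ne _)
  rw [← card_inv_mul_sum_char_mul_char_eq_finrank, charInner, finsum_eq_sum_of_fintype]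
  simp_rw [ρ.char_inv_eq_conj]

theorem charInner_character_ne_zero_iff (ρ : Representation ℂ G V) (σ : Representation ℂ G W) :
    charInner G σ.character ρ.character ≠ 0 ↔ ∃ f : IntertwiningMap ρ σ, f ≠ 0 := by
  have := Module.Finite.equiv (invariantsEquivIntertwiningMap ρ σ)
  rw [charInner_character, Nat.cast_ne_zero, ← Nat.pos_iff_ne_zero,
    Module.finrank_pos_iff_exists_ne_zero]

theorem FDRep.simple_of_isIrreducible (ρ : Representation ℂ G V) [ρ.IsIrreducible] :
    CategoryTheory.Simple (FDRep.of ρ) := by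
  rw [FDRep.simple_iff_end_is_rank_one, ← (linHom.invariantsEquivFDRepHom _ _).finrank_eq,
    (invariantsEquivIntertwiningMap _ _).finrank_eq]
  exact IsIrreducible.finrank_intertwiningMap_self ρ

theorem isIrrChar_character (ρ : Representation ℂ G V) [ρ.IsIrreducible] :
    IsIrrChar G ρ.character :=
  ⟨FDRep.of ρ, FDRep.simple_of_isIrreducible ρ, rfl⟩

end

theorem IsSemisimpleModule.simple_induction {R M : Type*} [Ring R] [AddCommGroup M] [Module R M]
    [IsSemisimpleModule R M] {p : M → Prop} (zero : p 0) (add : ∀ x y, p x → p y → p (x + y))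
    (simple : ∀ m : Submodule R M, IsSimpleModule R m → ∀ x ∈ m, p x) (x : M) : p x := by
  have hx : x ∈ sSup {m : Submodule R M | IsSimpleModule R m} := by
    rw [IsSemisimpleModule.sSup_simples_eq_top]; trivial
  rw [sSup_eq_iSup'] at hx
  exact Submodule.iSup_induction _ (motive := p) hx (fun m ↦ simple m m.2) zero add

section

variable {k G M : Type*} [Field k] [Group G] [AddCommGroup M] [Module k M] [Module k[G] M]
  [IsScalarTower k k[G] M]

theorem Representation.asAlgebraHom_ofModule'_apply (x : k[G]) (m : M) :
    (ofModule' (k := k) (G := G) M).asAlgebraHom x m = x • m := by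
  rw [asAlgebraHom_def, ofModule', _root_.Equiv.apply_symm_apply, Algebra.lsmul_coe]

theorem Representation.ofModule'_apply (g : G) (m : M) :
    ofModule' (k := k) (G := G) M g m = single g (1 : k) • m := by
  rw [← asAlgebraHom_single_one, asAlgebraHom_ofModule'_apply]

instance Representation.isIrreducible_ofModule' [IsSimpleModule k[G] M] :
    IsIrreducible (ofModule' (k := k) (G := G) M) := by
  rw [irreducible_iff_isSimpleModule_asModule]
  let e : (ofModule' (k := k) (G := G) M).asModule ≃ₗ[k[G]] M :=
    { (ofModule' (k := k) (G := G) M).asModuleEquiv.toAddEquiv with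
      map_smul' := fun x m ↦ asAlgebraHom_ofModule'_apply x _ }
  exact IsSimpleModule.congr e

theorem Representation.IsIrreducible.nontrivial {V : Type*} [AddCommGroup V] [Module k V]
    (ρ : Representation k G V) [ρ.IsIrreducible] : Nontrivial V := by
  exact IsSimpleModule.nontrivial k[G] ρ.asModule

end

section

variable {H V : Type} [Group H] [AddCommGroup V] [Module ℂ V]

/-- The elements of a simple left ideal act as zero on every irreducible representation whose
character differs from the one afforded by the ideal. -/
theorem asAlgebraHom_eq_zero_of_mem_simple (m : Submodule ℂ[H] ℂ[H]) [IsSimpleModule ℂ[H] m]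
    (ρ : Representation ℂ H V) [ρ.IsIrreducible]
    (hne : (ofModule' (k := ℂ) (G := H) m).character ≠ ρ.character) {x : ℂ[H]} (hx : x ∈ m) :
    ρ.asAlgebraHom x = 0 := by
  ext v
  let f : IntertwiningMap (ofModule' (k := ℂ) (G := H) m) ρ :=
    { toLinearMap := (LinearMap.applyₗ v ∘ₗ ρ.asAlgebraHom.toLinearMap) ∘ₗ
        (m.restrictScalars ℂ).subtype
      isIntertwining' := fun g ↦ by
        ext y
        change ρ.asAlgebraHom (ofModule' (k := ℂ) (G := H) m g y : m) v =
          ρ g (ρ.asAlgebraHom (y : ℂ[H]) v)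
        rw [ofModule'_apply, Submodule.coe_smul, smul_eq_mul, map_mul, asAlgebraHom_single_one,
          Module.End.mul_apply] }
  rcases IsIrreducible.bijective_or_eq_zero f with hf | hf
  · exact absurd (char_iso (f.ofBijective hf)) hne
  · exact congr($hf ⟨x, hx⟩)

/-- An element of the group algebra acting as the identity on the irreducible representations whose
characters satisfy `P`, and as zero on all the others. -/
theorem exists_separating_element [Finite H] (P : (H → ℂ) → Prop) :
    ∃ e : ℂ[H], ∀ (W : Type) [AddCommGroup W] [Module ℂ W] [FiniteDimensional ℂ W]
      (ρ : Representation ℂ H W) [ρ.IsIrreducible],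
      (P ρ.character → ρ.asAlgebraHom e = 1) ∧ (¬ P ρ.character → ρ.asAlgebraHom e = 0) := by
  suffices h : ∀ x : ℂ[H], ∃ e f : ℂ[H], x = e + f ∧
      ∀ (W : Type) [AddCommGroup W] [Module ℂ W] [FiniteDimensional ℂ W]
      (ρ : Representation ℂ H W) [ρ.IsIrreducible],
      (P ρ.character → ρ.asAlgebraHom f = 0) ∧ (¬ P ρ.character → ρ.asAlgebraHom e = 0) by
    obtain ⟨e, f, hef, h⟩ := h 1
    refine ⟨e, fun W _ _ _ ρ _ ↦ ⟨fun hP ↦ ?_, (h W ρ).2⟩⟩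
    rw [← map_one ρ.asAlgebraHom, hef, map_add, (h W ρ).1 hP, add_zero]
  refine IsSemisimpleModule.simple_induction (R := ℂ[H]) ⟨0, 0, by simp, by simp⟩ ?_ ?_
  · rintro _ _ ⟨e, f, rfl, h⟩ ⟨e', f', rfl, h'⟩
    refine ⟨e + e', f + f', by abel, fun W _ _ _ ρ _ ↦ ⟨fun hP ↦ ?_, fun hP ↦ ?_⟩⟩
    · rw [map_add, (h W ρ).1 hP, (h' W ρ).1 hP, add_zero]
    · rw [map_add, (h W ρ).2 hP, (h' W ρ).2 hP, add_zero]
  · intro m _ x hx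
    by_cases hm : P (ofModule' (k := ℂ) (G := H) m).character
    · refine ⟨x, 0, by simp, fun W _ _ _ ρ _ ↦ ⟨fun _ ↦ map_zero _, fun hP ↦ ?_⟩⟩
      exact asAlgebraHom_eq_zero_of_mem_simple m ρ (fun h ↦ hP (h ▸ hm)) hx
    · refine ⟨0, x, by simp, fun W _ _ _ ρ _ ↦ ⟨fun hP ↦ ?_, fun _ ↦ map_zero _⟩⟩
      exact asAlgebraHom_eq_zero_of_mem_simple m ρ (fun h ↦ hm (h ▸ hP)) hx

/-- An element of the group algebra acting as the same scalar on every irreducible constituent of a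
representation acts as that scalar on the whole representation. -/
theorem asAlgebraHom_eq_smul_one [Finite H] [FiniteDimensional ℂ V]
    (τ : Representation ℂ H V) (e : ℂ[H]) (c : ℂ)
    (h : ∀ (W : Type) [AddCommGroup W] [Module ℂ W] [FiniteDimensional ℂ W]
      (σ : Representation ℂ H W) [σ.IsIrreducible],
      (∃ f : IntertwiningMap σ τ, f ≠ 0) → σ.asAlgebraHom e = c • 1) :
    τ.asAlgebraHom e = c • 1 := by
  suffices hs : ∀ v : τ.asModule, e • v = c • v from LinearMap.ext hs
  refine IsSemisimpleModule.simple_induction (R := ℂ[H]) (by simp)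
    (fun x y hx hy ↦ by rw [smul_add, hx, hy, smul_add]) ?_
  intro m _ x hx
  have : FiniteDimensional ℂ m :=
    inferInstanceAs (FiniteDimensional ℂ (m.restrictScalars ℂ))
  let f : IntertwiningMap (ofModule' (k := ℂ) (G := H) m) τ :=
    { toLinearMap := τ.asModuleEquiv.toLinearMap ∘ₗ (m.restrictScalars ℂ).subtype
      isIntertwining' := fun g ↦ by
        ext y
        change τ.asModuleEquiv (ofModule' (k := ℂ) (G := H) m g y : m) =
          τ g (τ.asModuleEquiv (y : τ.asModule))
        rw [ofModule'_apply, Submodule.coe_smul, asModuleEquiv_map_smul, asAlgebraHom_single_one] }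
  have hf : f ≠ 0 := fun h0 ↦ by
    have := IsSimpleModule.nontrivial ℂ[H] m
    obtain ⟨y, hy⟩ := exists_ne (0 : m)
    exact hy (Subtype.ext (congr($h0 y)))
  have hm := congr($(h m (ofModule' m) ⟨f, hf⟩) ⟨x, hx⟩)
  rw [asAlgebraHom_ofModule'_apply] at hm
  exact congr(($hm).1)

end

section

variable {G : Type} [Group G] {H : Subgroup G}

theorem IsIrrChar.exists_representation {α : G → ℂ} (h : IsIrrChar G α) :
    ∃ (V : Type) (_ : AddCommGroup V) (_ : Module ℂ V) (_ : FiniteDimensional ℂ V)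
      (ρ : Representation ℂ G V), ρ.IsIrreducible ∧ ρ.character = α := by
  obtain ⟨X, hX, rfl⟩ := h
  exact ⟨X, inferInstance, inferInstance, inferInstance, X.ρ, X.isIrreducible_of_simple, rfl⟩

variable {V W : Type} [AddCommGroup V] [Module ℂ V] [AddCommGroup W] [Module ℂ W]

theorem charInner_resChar_ne_zero_iff [Finite G] [FiniteDimensional ℂ V] [FiniteDimensional ℂ W]
    (τ : Representation ℂ G V) (σ : Representation ℂ H W) :
    charInner H (resChar H τ.character) σ.character ≠ 0 ↔
      ∃ f : IntertwiningMap σ (τ.comp H.subtype), f ≠ 0 :=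
  charInner_character_ne_zero_iff σ (τ.comp H.subtype)

theorem LinkedPathLE.snoc {m : ℕ} {α β γ : H → ℂ} (h : LinkedPathLE H m α β)
    (hγ : IsIrrChar H γ) (hl : Linked H β γ) : LinkedPathLE H (m + 1) α γ := by
  obtain ⟨k, hk, f, h0, hβ, hirr, hlink⟩ := h
  refine ⟨k + 1, by omega, fun i ↦ if i ≤ k then f i else γ, by simpa using h0, by simp, ?_, ?_⟩
  · intro i _
    dsimp only
    split_ifs with h
    exacts [hirr i h, hγ]
  · intro i hi
    dsimp only
    rw [if_pos (by omega)]
    split_ifs with h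
    · exact hlink i (by omega)
    · obtain rfl : i = k := by omega
      rwa [hβ]

/-- A group algebra element supported on a core-free subgroup and commuting with all group elements
is a scalar. -/
theorem eq_single_one_of_commute (hH : H.normalCore = ⊥) (e : ℂ[H])
    (he : ∀ g : G, Commute (mapDomain H.subtype e) (single g 1)) : e = single 1 (e.coeff 1) := by
  have hcoe (h : H) : (mapDomain H.subtype e).coeff (h : G) = e.coeff h :=
    Finsupp.mapDomain_apply Subtype.val_injective _ _
  have hconj (g x : G) : (mapDomain H.subtype e).coeff (g * x * g⁻¹) =
      (mapDomain H.subtype e).coeff x := by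
    have := congr(($((he g).eq)).coeff (g * x))
    simpa using this
  ext h
  by_cases h1 : h = 1
  · subst h1; simp
  · rw [coeff_single, Finsupp.single_eq_of_ne h1]
    by_contra h0
    refine h1 (Subtype.ext (Subgroup.mem_bot.mp (hH ▸ fun g ↦ ?_)))
    by_contra hg
    refine h0 (((hcoe h).symm.trans (hconj g h).symm).trans ?_)
    exact Finsupp.mapDomain_of_notMem_range _ _ (by simpa using hg)

theorem asAlgebraHom_comp_subtype (τ : Representation ℂ G V) (e : ℂ[H]) :
    Representation.asAlgebraHom (τ.comp H.subtype) e =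
      τ.asAlgebraHom (mapDomain H.subtype e) := by
  induction e using MonoidAlgebra.induction_linear with
  | zero => simp
  | add x y hx hy => rw [map_add, hx, hy, mapDomain_add, map_add]
  | single h a => rw [mapDomain_single, asAlgebraHom_single, asAlgebraHom_single]; rfl

/-- If, for each irreducible representation of `G`, the element `e` of the group algebra of `H`
acts as a scalar, then `e` commutes with `G`. -/
theorem commute_of_acts_as_scalar [Finite G] (e : ℂ[H])
    (he : ∀ (V : Type) [AddCommGroup V] [Module ℂ V] [FiniteDimensional ℂ V]
      (τ : Representation ℂ G V) [τ.IsIrreducible],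
      ∃ c : ℂ, Representation.asAlgebraHom (τ.comp H.subtype) e = c • 1) (g : G) :
    Commute (mapDomain H.subtype e) (single g 1) := by
  suffices h : ∀ x : ℂ[G], mapDomain H.subtype e * (single g 1 * x) =
      single g 1 * (mapDomain H.subtype e * x) by
    have h1 := h 1
    rwa [mul_one, mul_one] at h1
  refine IsSemisimpleModule.simple_induction (R := ℂ[G]) (by simp)
    (fun x y hx hy ↦ by simp only [mul_add, hx, hy]) ?_
  intro m _ x hx
  obtain ⟨c, hc⟩ := he m (ofModule' (k := ℂ) (G := G) m)
  rw [asAlgebraHom_comp_subtype] at hc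
  have hsmul (y : m) : mapDomain H.subtype e * (y : ℂ[G]) = c • (y : ℂ[G]) := by
    have := congr($hc y)
    rw [asAlgebraHom_ofModule'_apply] at this
    exact congr(($this).1)
  have h1 := hsmul (single g (1 : ℂ) • ⟨x, hx⟩)
  rw [Submodule.coe_smul, smul_eq_mul] at h1
  rw [h1, hsmul ⟨x, hx⟩, mul_smul_comm]

theorem connected_of_normalCore_eq_bot [Finite G] (hH : H.normalCore = ⊥) {α β : H → ℂ}
    (hα : IsIrrChar H α) (hβ : IsIrrChar H β) : ∃ m : ℕ, LinkedPathLE H m α β := by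
  obtain ⟨e, he⟩ := exists_separating_element fun γ : H → ℂ ↦ ∃ m : ℕ, LinkedPathLE H m α γ
  have hscalar : e = single 1 (e.coeff 1) := by
    refine eq_single_one_of_commute hH e (commute_of_acts_as_scalar e fun V _ _ _ τ _ ↦ ?_)
    by_cases hτ : ∃ γ, IsIrrChar H γ ∧ charInner H (resChar H τ.character) γ ≠ 0 ∧
      ∃ m : ℕ, LinkedPathLE H m α γ
    · obtain ⟨γ, hγ, hγ0, m, hm⟩ := hτ
      refine ⟨1, asAlgebraHom_eq_smul_one _ e 1 fun W _ _ _ σ _ hσ ↦ ?_⟩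
      rw [one_smul]
      refine (he W σ).1 ⟨m + 1, hm.snoc (isIrrChar_character σ) ?_⟩
      exact ⟨τ.character, isIrrChar_character τ, hγ0, (charInner_resChar_ne_zero_iff τ σ).mpr hσ⟩
    · refine ⟨0, asAlgebraHom_eq_smul_one _ e 0 fun W _ _ _ σ _ hσ ↦ ?_⟩
      rw [zero_smul]
      exact (he W σ).2 fun hm ↦ hτ ⟨σ.character, isIrrChar_character σ,
        (charInner_resChar_ne_zero_iff τ σ).mpr hσ, hm⟩
  obtain ⟨V, _, _, _, ρ, _, rfl⟩ := hα.exists_representation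
  obtain ⟨W, _, _, _, σ, _, rfl⟩ := hβ.exists_representation
  by_contra hcon
  have hρ := (he V ρ).1 ⟨0, 0, le_rfl, fun _ ↦ ρ.character, rfl, rfl, fun _ _ ↦ hα, by simp⟩
  have hσ := (he W σ).2 hcon
  have := IsIrreducible.nontrivial ρ
  have := IsIrreducible.nontrivial σ
  rw [hscalar, asAlgebraHom_single, map_one ρ] at hρ
  rw [hscalar, asAlgebraHom_single, map_one σ] at hσ
  rcases smul_eq_zero.mp hσ with h | h
  · rw [h, zero_smul] at hρ
    exact zero_ne_one hρ
  · exact one_ne_zero h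

/-- Nonzero intertwining maps out of irreducible representations reflect trivially acting
elements. -/
theorem apply_eq_one_of_intertwiningMap {ρ : Representation ℂ H V} [ρ.IsIrreducible]
    {σ : Representation ℂ H W} {f : IntertwiningMap ρ σ} (hf : f ≠ 0) {n : H} (hn : σ n = 1) :
    ρ n = 1 := by
  have hinj := (IsIrreducible.injective_or_eq_zero f).resolve_right hf
  ext v
  refine hinj ?_
  rw [f.isIntertwining, hn]
  rfl

/-- If a normal subgroup `N` of `G` fixes a nonzero vector of an irreducible representation of `G`,
then it acts trivially. -/
theorem apply_eq_one_of_fixes (τ : Representation ℂ G V) [τ.IsIrreducible] (N : Subgroup G)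
    [N.Normal] {v : V} (hv0 : v ≠ 0) (hv : ∀ n ∈ N, τ n v = v) {n : G} (hn : n ∈ N) :
    τ n = 1 := by
  let F : Subrepresentation τ :=
    { toSubmodule :=
        { carrier := {v | ∀ n ∈ N, τ n v = v}
          add_mem' := fun hx hy n hn ↦ by rw [map_add, hx n hn, hy n hn]
          zero_mem' := fun n _ ↦ map_zero _
          smul_mem' := fun c x hx n hn ↦ by rw [map_smul, hx n hn] }
      apply_mem_toSubmodule := fun g x hx n hn ↦ by
        have h := hx (g⁻¹ * n * g) (by simpa using Subgroup.Normal.conj_mem ‹_› n hn g⁻¹)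
        conv_rhs => rw [← h]
        simp only [← Module.End.mul_apply, ← map_mul]
        group }
  have hF : F = ⊤ := (eq_bot_or_eq_top F).resolve_left fun h ↦ hv0 <| by
    have hvF : v ∈ F.toSubmodule := hv
    rw [h] at hvF
    exact (Submodule.mem_bot ℂ).mp hvF
  ext x
  have hx : x ∈ (⊤ : Subrepresentation τ).toSubmodule := Submodule.mem_top
  rw [← hF] at hx
  exact hx n hn

theorem normalCore_eq_bot_of_connected [Finite G]
    (hconn : ∀ α β : H → ℂ, IsIrrChar H α → IsIrrChar H β → ∃ m : ℕ, LinkedPathLE H m α β) :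
    H.normalCore = ⊥ := by
  let Q (α : H → ℂ) : Prop := ∀ (V : Type) [AddCommGroup V] [Module ℂ V] [FiniteDimensional ℂ V]
    (ρ : Representation ℂ H V) [ρ.IsIrreducible], ρ.character = α →
    ∀ n : H, (n : G) ∈ H.normalCore → ρ n = 1
  have hstep (α β : H → ℂ) (hα : IsIrrChar H α) (hQ : Q α) (hl : Linked H α β) : Q β := by
    obtain ⟨χ, hχ, hχα, hχβ⟩ := hl
    obtain ⟨V, _, _, _, τ, _, rfl⟩ := hχ.exists_representation
    obtain ⟨W, _, _, _, ρ, _, rfl⟩ := hα.exists_representation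
    obtain ⟨f, hf⟩ := (charInner_resChar_ne_zero_iff τ ρ).mp hχα
    have hinj := (IsIrreducible.injective_or_eq_zero f).resolve_right hf
    have := IsIrreducible.nontrivial ρ
    obtain ⟨w, hw⟩ := exists_ne (0 : W)
    have hτ {n : G} (hn : n ∈ H.normalCore) : τ n = 1 := by
      refine apply_eq_one_of_fixes τ H.normalCore (v := f w)
        (fun h ↦ hw (hinj (h.trans (map_zero f).symm))) (fun n hn ↦ ?_) hn
      have h := f.isIntertwining _ _ ⟨n, H.normalCore_le hn⟩ w
      rw [hQ W ρ rfl _ hn] at h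
      exact h.symm
    rintro U _ _ _ σ _ rfl n hn
    obtain ⟨f', hf'⟩ := (charInner_resChar_ne_zero_iff τ σ).mp hχβ
    exact apply_eq_one_of_intertwiningMap hf' (hτ hn)
  let ρ₀ : Representation ℂ H ℂ := 1
  have hρ₀ : ρ₀.IsIrreducible :=
    { exists_pair_ne := ⟨⊥, ⊤, fun h ↦ bot_ne_top (α := Submodule ℂ ℂ) congr(($h).toSubmodule)⟩
      eq_bot_or_eq_top := fun F ↦ (eq_bot_or_eq_top F.toSubmodule).imp
        (fun h ↦ Subrepresentation.toSubmodule_injective h)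
        (fun h ↦ Subrepresentation.toSubmodule_injective h) }
  have hbase : Q ρ₀.character := by
    intro V _ _ _ ρ _ hρ n _
    have h : charInner H ρ₀.character ρ.character ≠ 0 := by
      rw [hρ]
      exact (charInner_character_ne_zero_iff ρ₀ ρ₀).mpr
        ⟨.id ρ₀, fun h ↦ one_ne_zero (α := ℂ) congr($h 1)⟩
    obtain ⟨f, hf⟩ := (charInner_character_ne_zero_iff ρ ρ₀).mp h
    exact apply_eq_one_of_intertwiningMap hf rfl
  have hall (β : H → ℂ) (hβ : IsIrrChar H β) : Q β := by
    obtain ⟨m, k, hk, f, h0, rfl, hirr, hlink⟩ :=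
      hconn ρ₀.character β (isIrrChar_character ρ₀) hβ
    have : ∀ i ≤ k, Q (f i) := fun i hi ↦ by
      induction i with
      | zero => rwa [h0]
      | succ i ih => exact hstep _ _ (hirr i (by omega)) (ih (by omega)) (hlink i (by omega))
    exact this k le_rfl
  refine (Subgroup.eq_bot_iff_forall _).mpr fun n hn ↦ ?_
  have hfix : ∀ x : ℂ[H], single (⟨n, H.normalCore_le hn⟩ : H) (1 : ℂ) * x = x := by
    refine IsSemisimpleModule.simple_induction (R := ℂ[H]) (by simp)
      (fun x y hx hy ↦ by rw [mul_add, hx, hy]) ?_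
    intro m _ x hx
    have h := congr($(hall _ (isIrrChar_character (ofModule' (k := ℂ) (G := H) m)) m
      (ofModule' m) rfl ⟨n, H.normalCore_le hn⟩ hn) ⟨x, hx⟩)
    rw [ofModule'_apply] at h
    exact congr(($h).1)
  have h1 := hfix 1
  rw [mul_one, one_def] at h1
  exact congrArg Subtype.val (MonoidAlgebra.of_injective (R := ℂ) h1)

end

/-- `H` is core-free in `G` if and only if the Külshammer graph `K(G,H)`
is connected: any two irreducible complex characters of `H` are joined by a finite chain
in which consecutive characters are linked over `G`. -/
theorem corefree_iff_connected {G : Type} [Group G] [Finite G] (H : Subgroup G) :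
    H.normalCore = ⊥ ↔
      ∀ α β : ↥H → ℂ, IsIrrChar ↥H α → IsIrrChar ↥H β →
        ∃ m : ℕ, LinkedPathLE H m α β :=
  ⟨fun hH _ _ hα hβ ↦ connected_of_normalCore_eq_bot hH hα hβ, normalCore_eq_bot_of_connected⟩
end
end

section
/- Let G be a finite group, K ≤ H ≤ G subgroups, and m a positive integer. Suppose that any two irreducible complex characters of H are joined in the Külshammer graph K(G,H) by a path of length at most m. Then any two irreducible complex characters of K are joined in the Külshammer graph K(G,K) by a path of length at most m. (In particular, the diameter of K(G,K) is at most that of K(G,H), and consequently d_G(K) ≤ d_G(H) for core-free subgroups K ≤ H.) -/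
noncomputable section

open CategoryTheory Limits
open scoped ComplexOrder

section Characters

variable {A B : Type} [Group A] [Group B]

/-- In a matrix representation of a finite group, the trace of the inverse of an element is the
conjugate of its trace, since `∑ h, (R h)ᴴ * R h` is an invariant positive definite form. -/
theorem Matrix.trace_map_inv_eq_star {n : Type} [Fintype n] [DecidableEq n] [Finite A]
    (R : A →* Matrix n n ℂ) (g : A) : (R g⁻¹).trace = star (R g).trace := by
  classical
  have := Fintype.ofFinite A
  set P : Matrix n n ℂ := ∑ h : A, (R h).conjTranspose * R h with hP
  have hpos : P.PosDef := by
    rw [hP, ← Finset.add_sum_erase _ _ (Finset.mem_univ (1 : A))]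
    refine Matrix.PosDef.add_posSemidef (by simpa using Matrix.PosDef.one) ?_
    exact Matrix.posSemidef_sum _ fun h _ => Matrix.posSemidef_conjTranspose_mul_self _
  have hinv : (R g).conjTranspose * P * R g = P := by
    rw [hP, Finset.mul_sum, Finset.sum_mul]
    refine Fintype.sum_equiv (Equiv.mulRight g) _ _ fun h => ?_
    simp [Matrix.mul_assoc, Matrix.conjTranspose_mul]
  have hgg : R g * R g⁻¹ = 1 := by rw [← map_mul, mul_inv_cancel, map_one]
  have hcomm : P * R g⁻¹ = (R g).conjTranspose * P := by
    calc P * R g⁻¹ = (R g).conjTranspose * P * R g * R g⁻¹ := by rw [hinv]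
      _ = (R g).conjTranspose * P := by rw [Matrix.mul_assoc, hgg, Matrix.mul_one]
  have hu : IsUnit P.det := (Matrix.isUnit_iff_isUnit_det _).1 hpos.isUnit
  calc (R g⁻¹).trace = (P⁻¹ * (P * R g⁻¹)).trace := by
        rw [← Matrix.mul_assoc, Matrix.nonsing_inv_mul _ hu, Matrix.one_mul]
    _ = (R g).conjTranspose.trace := by
        rw [hcomm, Matrix.trace_mul_comm, Matrix.mul_assoc, Matrix.mul_nonsing_inv _ hu,
          Matrix.mul_one]
    _ = star (R g).trace := Matrix.trace_conjTranspose _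

theorem FDRep.char_inv_eq_conj [Finite A] (V : FDRep ℂ A) (g : A) :
    V.character g⁻¹ = (starRingEnd ℂ) (V.character g) := by
  classical
  let b := Module.finBasis ℂ V
  have key := Matrix.trace_map_inv_eq_star
    ((LinearMap.toMatrixAlgEquiv b).toMulEquiv.toMonoidHom.comp V.ρ) g
  simp only [FDRep.character, LinearMap.trace_eq_matrix_trace ℂ b]
  exact key

theorem charInner_ne_zero_iff [Finite A] (V W : FDRep ℂ A) :
    charInner A W.character V.character ≠ 0 ↔ ∃ f : V ⟶ W, f ≠ 0 := by
  have := Fintype.ofFinite A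
  have : Invertible (Nat.card A : ℂ) := invertibleOfNonzero (NeZero.ne _)
  have h : charInner A W.character V.character = Module.finrank ℂ (V ⟶ W) := by
    rw [← FDRep.scalar_product_char_eq_finrank_equivariant, charInner, finsum_eq_sum_of_fintype]
    simp only [FDRep.char_inv_eq_conj]
  rw [h, Nat.cast_ne_zero, ← Nat.pos_iff_ne_zero, Module.finrank_pos_iff_exists_ne_zero]

/-- A property of representations which passes from an object to a subobject or to the
corresponding quotient, and which fails for zero objects, is satisfied by a simple object as soon
as it is satisfied by some object. -/
theorem FDRep.exists_simple_of_mono_or_cokernel (P : FDRep ℂ A → Prop)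
    (hzero : ∀ W, P W → ¬ IsZero W)
    (hsplit : ∀ (U W : FDRep ℂ A) (i : U ⟶ W) [Mono i], P W → P U ∨ P (cokernel i))
    (W : FDRep ℂ A) (hW : P W) : ∃ S : FDRep ℂ A, Simple S ∧ P S := by
  induction hn : Module.finrank ℂ W using Nat.strong_induction_on generalizing W with
  | _ n ih =>
  subst hn
  by_cases hS : Simple W
  · exact ⟨W, hS, hW⟩
  obtain ⟨U, i, hi, hi0, hiso⟩ : ∃ (U : FDRep ℂ A) (i : U ⟶ W), Mono i ∧ i ≠ 0 ∧ ¬ IsIso i := by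
    by_contra! hcon
    refine hS ⟨fun {U} i _ => ⟨fun hi h0 => ?_, hcon U i inferInstance⟩⟩
    subst h0
    exact hzero W hW ((isIsoZero_iff_source_target_isZero _ _).1 hi).2
  let F : FDRep ℂ A ⥤ ModuleCat ℂ := Action.forget _ _ ⋙ forget₂ (FGModuleCat ℂ) (ModuleCat ℂ)
  rcases hsplit U W i hW with hU | hC
  · refine ih _ ?_ U hU rfl
    have hinj : Function.Injective (F.map i).hom :=
      (ModuleCat.mono_iff_injective _).1 inferInstance
    refine lt_of_le_of_ne (LinearMap.finrank_le_finrank_of_injective hinj) fun heq => hiso ?_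
    have hsurj : Function.Surjective (F.map i).hom :=
      (LinearMap.injective_iff_surjective_of_finrank_eq_finrank heq).1 hinj
    have : Epi (F.map i) := (ModuleCat.epi_iff_surjective _).2 hsurj
    have : Epi i := F.epi_of_epi_map this
    exact isIso_of_mono_of_epi i
  · refine ih _ ?_ _ hC rfl
    have hsurj : Function.Surjective (F.map (cokernel.π i)).hom :=
      (ModuleCat.epi_iff_surjective _).1 inferInstance
    refine lt_of_le_of_ne (LinearMap.finrank_le_finrank_of_surjective hsurj) fun heq => hi0 ?_
    have hinj : Function.Injective (F.map (cokernel.π i)).hom :=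
      (LinearMap.injective_iff_surjective_of_finrank_eq_finrank heq.symm).2 hsurj
    have : Mono (F.map (cokernel.π i)) := (ModuleCat.mono_iff_injective _).2 hinj
    have : Mono (cokernel.π i) := F.mono_of_mono_map this
    rw [← cancel_mono (cokernel.π i)]
    simp

/-- Every nonzero finite-dimensional representation receives a nonzero map from a simple one. -/
theorem FDRep.exists_simple_hom_ne_zero (V : FDRep ℂ A) (hV : 𝟙 V ≠ 0) :
    ∃ S : FDRep ℂ A, Simple S ∧ ∃ f : S ⟶ V, f ≠ 0 := by
  refine FDRep.exists_simple_of_mono_or_cokernel (fun W => ∃ f : W ⟶ V, f ≠ 0)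
    (fun W ⟨f, hf⟩ hW => hf (hW.eq_zero_of_src f)) (fun U W i _ ⟨f, hf⟩ => ?_) V ⟨_, hV⟩
  by_cases h : i ≫ f = 0
  · refine Or.inr ⟨cokernel.desc i f h, fun h0 => hf ?_⟩
    rw [← cokernel.π_desc i f h, h0, comp_zero]
  · exact Or.inl ⟨_, h⟩

/-- The representation of `B` on the functions `B → ℂ` by right translation. -/
def rightRegularFunctions (B : Type) [Group B] : Representation ℂ B (B → ℂ) where
  toFun b := LinearMap.funLeft ℂ ℂ (· * b)
  map_one' := by ext; simp [LinearMap.funLeft]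
  map_mul' a b := by ext; simp [LinearMap.funLeft, mul_assoc]

/-- The coefficient map of a linear form `l`, extended by zero along `φ`. -/
def coefficientExtension (φ : A →* B) (V : FDRep ℂ A) (l : V →ₗ[ℂ] ℂ) : V →ₗ[ℂ] (B → ℂ) :=
  (Function.ExtendByZero.linearMap ℂ φ).comp (LinearMap.pi fun a => l.comp (V.ρ a))

theorem coefficientExtension_apply_map (φ : A →* B) (hφ : Function.Injective φ) (V : FDRep ℂ A)
    (l : V →ₗ[ℂ] ℂ) (v : V) (a : A) : coefficientExtension φ V l v (φ a) = l (V.ρ a v) := by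
  simp [coefficientExtension, hφ.extend_apply]

theorem coefficientExtension_apply_of_notMem (φ : A →* B) (V : FDRep ℂ A)
    (l : V →ₗ[ℂ] ℂ) (v : V) (b : B) (hb : b ∉ φ.range) : coefficientExtension φ V l v b = 0 := by
  have : ¬ ∃ a, φ a = b := hb
  simp [coefficientExtension, Function.extend_apply' _ _ _ this]

theorem coefficientExtension_equivariant (φ : A →* B) (hφ : Function.Injective φ) (V : FDRep ℂ A)
    (l : V →ₗ[ℂ] ℂ) (a : A) (v : V) :
    coefficientExtension φ V l (V.ρ a v) =
      rightRegularFunctions B (φ a) (coefficientExtension φ V l v) := by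
  ext b
  change _ = coefficientExtension φ V l v (b * φ a)
  by_cases hb : b ∈ φ.range
  · obtain ⟨c, rfl⟩ := hb
    rw [← map_mul, coefficientExtension_apply_map φ hφ, coefficientExtension_apply_map φ hφ,
      map_mul, Module.End.mul_apply]
  · have hba : b * φ a ∉ φ.range := fun h => hb <| by
      simpa using φ.range.mul_mem h (φ.range.inv_mem ⟨a, rfl⟩)
    rw [coefficientExtension_apply_of_notMem φ V l _ _ hb,
      coefficientExtension_apply_of_notMem φ V l _ _ hba]

theorem exists_hom_res_rightRegularFunctions [Finite B] (φ : A →* B) (hφ : Function.Injective φ)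
    (V : FDRep ℂ A) (hV : 𝟙 V ≠ 0) :
    ∃ f : V ⟶ (Action.res _ φ).obj (FDRep.of (rightRegularFunctions B)), f ≠ 0 := by
  obtain ⟨v, hv⟩ : ∃ v : V, v ≠ 0 := by
    by_contra! h
    refine hV ?_
    ext v
    exact h v
  obtain ⟨l, hl⟩ : ∃ l : Module.Dual ℂ V, l v ≠ 0 := by
    by_contra! h
    exact hv ((Module.forall_dual_apply_eq_zero_iff ℂ v).1 h)
  refine ⟨⟨InducedCategory.homMk (ModuleCat.ofHom (coefficientExtension φ V l)), fun a => ?_⟩,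
    fun h => hl ?_⟩
  · ext v : 3
    exact coefficientExtension_equivariant φ hφ V l a v
  · have h0 : coefficientExtension φ V l v = 0 :=
      congrArg (fun f : V ⟶ (Action.res _ φ).obj (FDRep.of (rightRegularFunctions B)) =>
        f.hom.hom.hom v) h
    have h1 := coefficientExtension_apply_map φ hφ V l v 1
    rw [h0, map_one V.ρ, Module.End.one_apply] at h1
    exact h1.symm

/-- Every nonzero representation of `A` maps nontrivially to the restriction of a simple one of
`B`. -/
theorem FDRep.exists_simple_hom_res_ne_zero [Finite B] (φ : A →* B) (hφ : Function.Injective φ)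
    (V : FDRep ℂ A) (hV : 𝟙 V ≠ 0) :
    ∃ S : FDRep ℂ B, Simple S ∧ ∃ f : V ⟶ (Action.res _ φ).obj S, f ≠ 0 := by
  refine FDRep.exists_simple_of_mono_or_cokernel
    (fun W => ∃ f : V ⟶ (Action.res _ φ).obj W, f ≠ 0)
    (fun W ⟨f, hf⟩ hW => hf (((Action.res _ φ).map_isZero hW).eq_zero_of_tgt f))
    (fun U W i _ ⟨f, hf⟩ => ?_) _ (exists_hom_res_rightRegularFunctions φ hφ V hV)
  let r : W ⟶ U := Injective.factorThru (𝟙 U) i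
  have hr : i ≫ r = 𝟙 U := Injective.comp_factorThru _ _
  let s : cokernel i ⟶ W := cokernel.desc i (𝟙 W - r ≫ i) (by simp [reassoc_of% hr])
  have hs : 𝟙 W = r ≫ i + cokernel.π i ≫ s := by simp [s]
  by_contra! h
  refine hf ?_
  rw [← Category.comp_id f, ← (Action.res _ φ).map_id, hs, Functor.map_add, Functor.map_comp,
    Functor.map_comp, Preadditive.comp_add, ← Category.assoc, ← Category.assoc,
    h.1 (f ≫ (Action.res _ φ).map r), h.2 (f ≫ (Action.res _ φ).map (cokernel.π i)), zero_comp, zero_comp, add_zero]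

theorem FDRep.comp_res_map_ne_zero [Finite B] (φ : A →* B) {U : FDRep ℂ A} {V W : FDRep ℂ B}
    [Simple V] (g : U ⟶ (Action.res _ φ).obj V) (hg : g ≠ 0) (f : V ⟶ W) (hf : f ≠ 0) :
    g ≫ (Action.res _ φ).map f ≠ 0 := by
  have := mono_of_nonzero_from_simple hf
  intro h
  refine hg ?_
  rw [← Category.comp_id g, ← (Action.res _ φ).map_id,
    ← Injective.comp_factorThru (𝟙 V) f, Functor.map_comp, ← Category.assoc, h, zero_comp]

theorem IsIrrChar.exists_charInner_comp_ne_zero [Finite B] (φ : A →* B)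
    (hφ : Function.Injective φ) {γ : A → ℂ} (hγ : IsIrrChar A γ) :
    ∃ α, IsIrrChar B α ∧ charInner A (α ∘ φ) γ ≠ 0 := by
  have := Finite.of_injective φ hφ
  obtain ⟨V, hV, rfl⟩ := hγ
  obtain ⟨S, hS, hf⟩ := FDRep.exists_simple_hom_res_ne_zero φ hφ V (id_nonzero V)
  exact ⟨_, ⟨S, hS, rfl⟩, (charInner_ne_zero_iff V ((Action.res _ φ).obj S)).2 hf⟩

theorem IsIrrChar.exists_comp_charInner_ne_zero [Finite A] (φ : A →* B)
    {α : B → ℂ} (hα : IsIrrChar B α) :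
    ∃ γ, IsIrrChar A γ ∧ charInner A (α ∘ φ) γ ≠ 0 := by
  obtain ⟨V, hV, rfl⟩ := hα
  have h : 𝟙 ((Action.res _ φ).obj V) ≠ 0 := fun h => by
    have hhom := congrArg Action.Hom.hom h
    exact id_nonzero V (Action.Hom.ext hhom)
  obtain ⟨S, hS, hf⟩ := FDRep.exists_simple_hom_ne_zero _ h
  exact ⟨_, ⟨S, hS, rfl⟩, (charInner_ne_zero_iff S ((Action.res _ φ).obj V)).2 hf⟩

theorem charInner_comp_ne_zero_trans {C : Type} [Group C] [Finite A] [Finite B]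
    (φ : A →* B) (ψ : B →* C) {γ : A → ℂ} {α : B → ℂ} {χ : C → ℂ}
    (hγ : IsIrrChar A γ) (hα : IsIrrChar B α) (hχ : IsIrrChar C χ)
    (h₁ : charInner A (α ∘ φ) γ ≠ 0) (h₂ : charInner B (χ ∘ ψ) α ≠ 0) :
    charInner A (χ ∘ ψ ∘ φ) γ ≠ 0 := by
  obtain ⟨U, hU, rfl⟩ := hγ
  obtain ⟨V, hV, rfl⟩ := hα
  obtain ⟨W, hW, rfl⟩ := hχ
  obtain ⟨g, hg⟩ := (charInner_ne_zero_iff U ((Action.res _ φ).obj V)).1 h₁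
  obtain ⟨f, hf⟩ := (charInner_ne_zero_iff V ((Action.res _ ψ).obj W)).1 h₂
  exact (charInner_ne_zero_iff U ((Action.res _ φ).obj ((Action.res _ ψ).obj W))).2
    ⟨_, FDRep.comp_res_map_ne_zero φ g hg f hf⟩

end Characters

theorem Linked.of_le {G : Type} [Group G] [Finite G] {K H : Subgroup G} (hKH : K ≤ H)
    {α β : H → ℂ} {γ δ : K → ℂ} (hα : IsIrrChar H α) (hβ : IsIrrChar H β)
    (hγ : IsIrrChar K γ) (hδ : IsIrrChar K δ)
    (hαγ : charInner K (α ∘ Subgroup.inclusion hKH) γ ≠ 0)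
    (hβδ : charInner K (β ∘ Subgroup.inclusion hKH) δ ≠ 0) (h : Linked H α β) :
    Linked K γ δ := by
  obtain ⟨χ, hχ, h₁, h₂⟩ := h
  exact ⟨χ, hχ, charInner_comp_ne_zero_trans _ H.subtype hγ hα hχ hαγ h₁,
    charInner_comp_ne_zero_trans _ H.subtype hδ hβ hχ hβδ h₂⟩

theorem Linked.refl {G : Type} [Group G] [Finite G] {H : Subgroup G} {α : H → ℂ}
    (hα : IsIrrChar H α) : Linked H α α := by
  obtain ⟨χ, hχ, h⟩ := hα.exists_charInner_comp_ne_zero H.subtype H.subtype_injective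
  exact ⟨χ, hχ, h, h⟩

/-- If `K ≤ H ≤ G` and any two irreducible characters of `H` are joined
in `K(G,H)` by a path of length at most `m`, then any two irreducible characters of `K`
are joined in `K(G,K)` by a path of length at most `m`. -/
theorem diameter_mono {G : Type} [Group G] [Finite G] (K H : Subgroup G) (hKH : K ≤ H)
    (m : ℕ) (hm : 0 < m)
    (hH : ∀ α β : ↥H → ℂ, IsIrrChar ↥H α → IsIrrChar ↥H β → LinkedPathLE H m α β) :
    ∀ γ δ : ↥K → ℂ, IsIrrChar ↥K γ → IsIrrChar ↥K δ → LinkedPathLE K m γ δ := by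
  intro γ δ hγ hδ
  have hinj := Subgroup.inclusion_injective hKH
  obtain ⟨α, hα, hαγ⟩ := hγ.exists_charInner_comp_ne_zero _ hinj
  obtain ⟨β, hβ, hβδ⟩ := hδ.exists_charInner_comp_ne_zero _ hinj
  obtain ⟨k, hk, f, rfl, rfl, hf, hlink⟩ := hH α β hα hβ
  obtain rfl | hk0 := Nat.eq_zero_or_pos k
  · refine ⟨1, hm, fun i => if i = 0 then γ else δ, rfl, rfl, fun i _ => ?_, fun i hi => ?_⟩
    · dsimp only
      split_ifs
      exacts [hγ, hδ]
    · obtain rfl : i = 0 := by omega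
      exact Linked.of_le hKH hα hα hγ hδ hαγ hβδ (Linked.refl hα)
  · have hbelow : ∀ i, ∃ ε : K → ℂ, i ≤ k → IsIrrChar K ε ∧
        charInner K (f i ∘ Subgroup.inclusion hKH) ε ≠ 0 ∧ (i = 0 → ε = γ) ∧ (i = k → ε = δ) := by
      intro i
      by_cases hi : i ≤ k
      · obtain rfl | hi0 := Nat.eq_zero_or_pos i
        · exact ⟨γ, fun _ => ⟨hγ, hαγ, fun _ => rfl, fun h => absurd h hk0.ne⟩⟩
        obtain rfl | hik := eq_or_ne i k
        · exact ⟨δ, fun _ => ⟨hδ, hβδ, fun h => absurd h hi0.ne', fun _ => rfl⟩⟩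
        obtain ⟨ε, hε, hfε⟩ := (hf i hi).exists_comp_charInner_ne_zero (Subgroup.inclusion hKH)
        exact ⟨ε, fun _ => ⟨hε, hfε, fun h => absurd h hi0.ne', fun h => absurd h hik⟩⟩
      · exact ⟨γ, fun h => absurd h hi⟩
    choose e he using hbelow
    refine ⟨k, hk, e, (he 0 hk0.le).2.2.1 rfl, (he k le_rfl).2.2.2 rfl, fun i hi => (he i hi).1,
      fun i hi => ?_⟩
    exact Linked.of_le hKH (hf i hi.le) (hf (i + 1) hi) (he i hi.le).1 (he (i + 1) hi).1
      (he i hi.le).2.1 (he (i + 1) hi).2.1 (hlink i hi)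
end
end
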